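/- Let R = X ⊕ Y be an 8×8 complex matrix where X = (1/√2)·[[A,B],[C,D]] and Y = (1/√2)·[[Y₁,Y₂],[Y₃,Y₄]] are written in 2×2 blocks. If at least one of the eight blocks A, B, C, D, Y₁, Y₂, Y₃, Y₄ is not a diagonal 2×2 matrix, and (R ⊗ I₄)·(I₄ ⊗ R) = (I₄ ⊗ R)·(R ⊗ I₄) as 32×32 matrices (where ⊗ denotes the Kronecker product and I₄ the 4×4 identity matrix), then X = Y. -/

import Mathlib

open Matrix Complex
open scoped Kronecker

/-- Block diagonal sum `X ⊕ Y` of two 4×4 matrices, as an 8×8 matrix. -/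
noncomputable def dSum (X Y : Matrix (Fin 4) (Fin 4) ℂ) : Matrix (Fin 8) (Fin 8) ℂ :=
  Matrix.reindex finSumFinEquiv finSumFinEquiv (Matrix.fromBlocks X 0 0 Y)

/-- A 4×4 matrix assembled from 2×2 blocks, scaled by `1/√2`. -/
noncomputable def blk (A B C D : Matrix (Fin 2) (Fin 2) ℂ) : Matrix (Fin 4) (Fin 4) ℂ :=
  Matrix.reindex finSumFinEquiv finSumFinEquiv
    ((Real.sqrt 2 : ℂ)⁻¹ • Matrix.fromBlocks A B C D)

/-- Far commutativity: `(R ⊗ I₄)(I₄ ⊗ R) = (I₄ ⊗ R)(R ⊗ I₄)` as 32×32 matrices. -/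
def farComm (R : Matrix (Fin 8) (Fin 8) ℂ) : Prop :=
  Matrix.reindex finProdFinEquiv finProdFinEquiv (R ⊗ₖ (1 : Matrix (Fin 4) (Fin 4) ℂ)) *
      Matrix.reindex finProdFinEquiv finProdFinEquiv ((1 : Matrix (Fin 4) (Fin 4) ℂ) ⊗ₖ R) =
    Matrix.reindex finProdFinEquiv finProdFinEquiv ((1 : Matrix (Fin 4) (Fin 4) ℂ) ⊗ₖ R) *
      Matrix.reindex finProdFinEquiv finProdFinEquiv (R ⊗ₖ (1 : Matrix (Fin 4) (Fin 4) ℂ))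

lemma far_entry (R : Matrix (Fin 8) (Fin 8) ℂ) (h : farComm R)
    (hR : ∀ a b : Fin 8, a.val / 4 ≠ b.val / 4 → R a b = 0) (i i' : Fin 8) (j j' : Fin 4) :
    R i i' * R ⟨4 * (i'.val % 2) + j.val, by omega⟩ ⟨4 * (i'.val % 2) + j'.val, by omega⟩ =
      R ⟨4 * (i.val % 2) + j.val, by omega⟩ ⟨4 * (i.val % 2) + j'.val, by omega⟩ * R i i' := by
  have key := congrFun (congrFun h (⟨4 * i.val + j.val, by omega⟩ : Fin (8 * 4)))
    (⟨4 * i'.val + j'.val, by omega⟩ : Fin (8 * 4))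
  have e1 : ∀ (x : Fin 8) (y : Fin 4) (hx : 4 * x.val + y.val < 8 * 4),
      (finProdFinEquiv (m := 8) (n := 4)).symm ⟨4 * x.val + y.val, hx⟩ = (x, y) := by
    intro x y hx
    rw [Equiv.symm_apply_eq]
    ext
    simp [finProdFinEquiv]
    omega
  have e2 : ∀ (x : Fin 8) (y : Fin 4) (hx : 4 * x.val + y.val < 8 * 4),
      (finProdFinEquiv (m := 4) (n := 8)).symm ⟨4 * x.val + y.val, hx⟩ =
        (⟨x.val / 2, by omega⟩, ⟨4 * (x.val % 2) + y.val, by omega⟩) := by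
    intro x y hx
    rw [Equiv.symm_apply_eq]
    ext
    simp [finProdFinEquiv]
    omega
  have cover : ∀ t : Fin (8 * 4), ∃ (x : Fin 8) (y : Fin 4) (hx : 4 * x.val + y.val < 8 * 4),
      t = ⟨4 * x.val + y.val, hx⟩ := by
    intro t
    refine ⟨⟨t.val / 4, by omega⟩, ⟨t.val % 4, by omega⟩, ?_, ?_⟩
    · simp only; omega
    · ext; simp only; omega
  rw [Matrix.mul_apply, Matrix.mul_apply] at key
  rw [Finset.sum_eq_single (⟨4 * i'.val + j.val, by omega⟩ : Fin (8 * 4)),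
    Finset.sum_eq_single (⟨4 * i.val + j'.val, by omega⟩ : Fin (8 * 4))] at key
  · simp only [Matrix.reindex_apply, Matrix.submatrix_apply] at key
    erw [e1, e1, e2, e2, e1, e1, e2, e2] at key
    simpa [Matrix.kroneckerMap_apply] using key
  · intro t _ ht
    obtain ⟨x, y, hx, rfl⟩ := cover t
    simp only [Matrix.reindex_apply, Matrix.submatrix_apply]
    erw [e1, e1, e2, e2]
    simp only [Matrix.kroneckerMap_apply, Matrix.one_apply, Fin.mk.injEq]
    by_cases h2 : y = j'
    · by_cases h3 : x = i
      · subst h2 h3; exact absurd rfl ht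
      · by_cases h1 : i.val / 2 = x.val / 2
        · rw [hR ⟨4 * (i.val % 2) + j.val, _⟩ ⟨4 * (x.val % 2) + y.val, _⟩
            (by simp only; omega)]
          simp
        · simp [h1]
    · simp [h2]
  · simp
  · intro t _ ht
    obtain ⟨x, y, hx, rfl⟩ := cover t
    simp only [Matrix.reindex_apply, Matrix.submatrix_apply]
    erw [e1, e1, e2, e2]
    simp only [Matrix.kroneckerMap_apply, Matrix.one_apply, Fin.mk.injEq]
    by_cases h2 : j = y
    · by_cases h3 : x = i'
      · subst h2 h3; exact absurd rfl ht
      · by_cases h1 : x.val / 2 = i'.val / 2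
        · rw [hR ⟨4 * (x.val % 2) + y.val, _⟩ ⟨4 * (i'.val % 2) + j'.val, _⟩
            (by simp only; omega)]
          simp
        · simp [h1]
    · simp [h2]
  · simp

theorem farComm_nondiag_implies_eq (A B C D Y1 Y2 Y3 Y4 : Matrix (Fin 2) (Fin 2) ℂ)
    (hnd : ¬ A.IsDiag ∨ ¬ B.IsDiag ∨ ¬ C.IsDiag ∨ ¬ D.IsDiag ∨
      ¬ Y1.IsDiag ∨ ¬ Y2.IsDiag ∨ ¬ Y3.IsDiag ∨ ¬ Y4.IsDiag)
    (hfc : farComm (dSum (blk A B C D) (blk Y1 Y2 Y3 Y4))) :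
    blk A B C D = blk Y1 Y2 Y3 Y4 := by
  by_contra hne
  have hjj : ∃ j j', blk A B C D j j' ≠ blk Y1 Y2 Y3 Y4 j j' := by
    by_contra hcon
    push Not at hcon
    exact hne (Matrix.ext hcon)
  obtain ⟨j, j', hj⟩ := hjj
  set X := blk A B C D with hX
  set Y := blk Y1 Y2 Y3 Y4 with hY
  have hXe : ∀ a b : Fin 4, dSum X Y (Fin.castAdd 4 a) (Fin.castAdd 4 b) = X a b := by
    intro a b
    simp only [dSum, Matrix.reindex_apply, Matrix.submatrix_apply]
    erw [finSumFinEquiv_symm_apply_castAdd, finSumFinEquiv_symm_apply_castAdd]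
    simp
  have hYe : ∀ a b : Fin 4, dSum X Y (Fin.natAdd 4 a) (Fin.natAdd 4 b) = Y a b := by
    intro a b
    simp only [dSum, Matrix.reindex_apply, Matrix.submatrix_apply]
    erw [finSumFinEquiv_symm_apply_natAdd, finSumFinEquiv_symm_apply_natAdd]
    simp
  have hR : ∀ a b : Fin 8, a.val / 4 ≠ b.val / 4 → dSum X Y a b = 0 := by
    intro a b hab
    simp only [dSum, Matrix.reindex_apply, Matrix.submatrix_apply]
    obtain ⟨u, rfl⟩ := (finSumFinEquiv (m := 4) (n := 4)).surjective a
    obtain ⟨v, rfl⟩ := (finSumFinEquiv (m := 4) (n := 4)).surjective b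
    erw [Equiv.symm_apply_apply, Equiv.symm_apply_apply]
    rcases u with u | u <;> rcases v with v | v
    · exact absurd (by simp only [finSumFinEquiv_apply_left, Fin.val_castAdd]; omega) hab
    · rfl
    · rfl
    · exact absurd (by simp only [finSumFinEquiv_apply_right, Fin.val_natAdd]; omega) hab
  have hzero : ∀ i i' : Fin 8, i.val % 2 ≠ i'.val % 2 → dSum X Y i i' = 0 := by
    intro i i' hii
    have hk := far_entry _ hfc hR i i' j j'
    have hd : ∀ c : ℕ, ∀ h1 h2, c = 0 → dSum X Y ⟨4 * c + j.val, h1⟩ ⟨4 * c + j'.val, h2⟩ = X j j' := by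
      rintro c h1 h2 rfl
      rw [← hXe]
      congr 1 <;> ext <;> simp
    have hd' : ∀ c : ℕ, ∀ h1 h2, c = 1 → dSum X Y ⟨4 * c + j.val, h1⟩ ⟨4 * c + j'.val, h2⟩ = Y j j' := by
      rintro c h1 h2 rfl
      rw [← hYe]
      congr 1
    rcases Nat.mod_two_eq_zero_or_one i.val with hi | hi
    · rw [hd' (i'.val % 2) _ _ (by omega), hd (i.val % 2) _ _ hi] at hk
      have : dSum X Y i i' * (Y j j' - X j j') = 0 := by linear_combination hk
      exact (mul_eq_zero.mp this).resolve_right (sub_ne_zero.mpr hj.symm)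
    · rw [hd (i'.val % 2) _ _ (by omega), hd' (i.val % 2) _ _ hi] at hk
      have : dSum X Y i i' * (X j j' - Y j j') = 0 := by linear_combination hk
      exact (mul_eq_zero.mp this).resolve_right (sub_ne_zero.mpr hj)
  have hX0 : ∀ a b : Fin 4, a.val % 2 ≠ b.val % 2 → X a b = 0 := by
    intro a b hab
    rw [← hXe]
    apply hzero
    simpa using hab
  have hY0 : ∀ a b : Fin 4, a.val % 2 ≠ b.val % 2 → Y a b = 0 := by
    intro a b hab
    rw [← hYe]
    apply hzero
    simp only [Fin.val_natAdd]
    omega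
  have hs : ((Real.sqrt 2 : ℝ) : ℂ)⁻¹ ≠ 0 := by simp
  have hblk : ∀ P Q S T : Matrix (Fin 2) (Fin 2) ℂ,
      (∀ a b : Fin 4, a.val % 2 ≠ b.val % 2 → blk P Q S T a b = 0) →
      P.IsDiag ∧ Q.IsDiag ∧ S.IsDiag ∧ T.IsDiag := by
    intro P Q S T hz
    refine ⟨?_, ?_, ?_, ?_⟩ <;> intro a b hab
    · have := hz (Fin.castAdd 2 a) (Fin.castAdd 2 b) (by simp only [Fin.val_castAdd]; omega)
      simp only [blk, Matrix.reindex_apply, Matrix.submatrix_apply] at this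
      erw [finSumFinEquiv_symm_apply_castAdd, finSumFinEquiv_symm_apply_castAdd] at this
      simpa using this
    · have := hz (Fin.castAdd 2 a) (Fin.natAdd 2 b)
        (by simp only [Fin.val_castAdd, Fin.val_natAdd]; omega)
      simp only [blk, Matrix.reindex_apply, Matrix.submatrix_apply] at this
      erw [finSumFinEquiv_symm_apply_castAdd, finSumFinEquiv_symm_apply_natAdd] at this
      simpa using this
    · have := hz (Fin.natAdd 2 a) (Fin.castAdd 2 b)
        (by simp only [Fin.val_castAdd, Fin.val_natAdd]; omega)
      simp only [blk, Matrix.reindex_apply, Matrix.submatrix_apply] at this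
      erw [finSumFinEquiv_symm_apply_natAdd, finSumFinEquiv_symm_apply_castAdd] at this
      simpa using this
    · have := hz (Fin.natAdd 2 a) (Fin.natAdd 2 b) (by simp only [Fin.val_natAdd]; omega)
      simp only [blk, Matrix.reindex_apply, Matrix.submatrix_apply] at this
      erw [finSumFinEquiv_symm_apply_natAdd, finSumFinEquiv_symm_apply_natAdd] at this
      simpa using this
  have h1 := hblk A B C D hX0
  have h2 := hblk Y1 Y2 Y3 Y4 hY0
  tauto
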